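/- Let g : ℝ² → ℝ be given by a bivariate polynomial of degree at most p in the first variable and at most q in the second variable, define A_g(u,v) = ∫₀^v g(u,ξ) dξ, and let u, v : ℝ → ℝ be univariate polynomials of degree at most d. Then F(s) = A_g(u(s), v(s)) · u′(s) is a univariate polynomial of degree at most d(p+q+2) − 1. Consequently, any quadrature rule with nodes s₁, …, s_N ∈ [0,1] and weights ω₁, …, ω_N that is exact for all univariate polynomials of degree at most d(p+q+2) − 1 (i.e., Σ_{μ=1}^N ω_μ P(s_μ) = ∫₀¹ P(s) ds for every such polynomial P) satisfies Σ_{μ=1}^N ω_μ F(s_μ) = ∫₀¹ F(s) ds. -/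

import Mathlib

open MeasureTheory

/-- `f : ℝ² → ℝ` is a bivariate polynomial of degree at most `m` in the first variable and at
most `n` in the second variable. -/
def IsBiPoly (m n : ℕ) (f : ℝ → ℝ → ℝ) : Prop :=
  ∃ c : ℕ → ℕ → ℝ, ∀ u v : ℝ,
    f u v = ∑ j ∈ Finset.range (m + 1), ∑ k ∈ Finset.range (n + 1), c j k * u ^ j * v ^ k

/-- `f : ℝ → ℝ` is a univariate polynomial of degree at most `d`. -/
def IsPolyDeg (d : ℕ) (f : ℝ → ℝ) : Prop :=
  ∃ c : ℕ → ℝ, ∀ t : ℝ, f t = ∑ j ∈ Finset.range (d + 1), c j * t ^ j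

open Polynomial in
theorem isPolyDeg_iff_exists_polynomial (d : ℕ) (f : ℝ → ℝ) :
    IsPolyDeg d f ↔ ∃ P : ℝ[X], P.natDegree ≤ d ∧ ∀ t, f t = P.eval t := by
  constructor
  · rintro ⟨c, hc⟩
    refine ⟨∑ j ∈ Finset.range (d + 1), C (c j) * X ^ j, ?_, fun t => ?_⟩
    · refine natDegree_sum_le_of_forall_le _ _ fun j hj => ?_
      exact (natDegree_C_mul_X_pow_le _ _).trans (Nat.lt_succ_iff.mp (Finset.mem_range.mp hj))
    · simp [hc, eval_finsetSum]
  · rintro ⟨P, hP, hf⟩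
    refine ⟨P.coeff, fun t => ?_⟩
    rw [hf, eval_eq_sum_range' (Nat.lt_succ_of_le hP)]

theorem integral_biPoly (p q : ℕ) (c : ℕ → ℕ → ℝ) (x y : ℝ) :
    ∫ ξ in (0:ℝ)..y, ∑ j ∈ Finset.range (p + 1), ∑ k ∈ Finset.range (q + 1),
        c j k * x ^ j * ξ ^ k =
      ∑ j ∈ Finset.range (p + 1), ∑ k ∈ Finset.range (q + 1),
        c j k / (k + 1) * x ^ j * y ^ (k + 1) := by
  rw [intervalIntegral.integral_finsetSum
    fun j _ => Continuous.intervalIntegrable (by fun_prop) _ _]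
  refine Finset.sum_congr rfl fun j _ => ?_
  rw [intervalIntegral.integral_finsetSum
    fun k _ => Continuous.intervalIntegrable (by fun_prop) _ _]
  refine Finset.sum_congr rfl fun k _ => ?_
  rw [intervalIntegral.integral_const_mul, integral_pow]
  simp only [ne_eq, Nat.add_eq_zero_iff, one_ne_zero, and_false, not_false_eq_true, zero_pow,
    sub_zero]
  ring

open Polynomial in
theorem isPolyDeg_pullback (p q d : ℕ) (g : ℝ → ℝ → ℝ) (hg : IsBiPoly p q g)
    (u v : ℝ → ℝ) (hu : IsPolyDeg d u) (hv : IsPolyDeg d v) :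
    IsPolyDeg (d * (p + q + 2) - 1)
      (fun s => (∫ ξ in (0:ℝ)..(v s), g (u s) ξ) * deriv u s) := by
  obtain ⟨c, hc⟩ := hg
  obtain ⟨U, hU, hu⟩ := (isPolyDeg_iff_exists_polynomial d u).1 hu
  obtain ⟨V, hV, hv⟩ := (isPolyDeg_iff_exists_polynomial d v).1 hv
  obtain rfl : u = fun t => U.eval t := funext hu
  obtain rfl : v = fun t => V.eval t := funext hv
  refine (isPolyDeg_iff_exists_polynomial _ _).2
    ⟨(∑ j ∈ Finset.range (p + 1), ∑ k ∈ Finset.range (q + 1),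
      C (c j k / (k + 1)) * U ^ j * V ^ (k + 1)) * derivative U, ?_, fun t => ?_⟩
  · rcases Nat.eq_zero_or_pos d with rfl | hd
    · simp [derivative_of_natDegree_zero (Nat.le_zero.mp hU)]
    have hA : (∑ j ∈ Finset.range (p + 1), ∑ k ∈ Finset.range (q + 1),
        C (c j k / (k + 1)) * U ^ j * V ^ (k + 1)).natDegree ≤ d * (p + q + 1) := by
      refine natDegree_sum_le_of_forall_le _ _ fun j hj =>
        natDegree_sum_le_of_forall_le _ _ fun k hk => ?_
      have hj' : j ≤ p := Nat.lt_succ_iff.mp (Finset.mem_range.mp hj)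
      have hk' : k ≤ q := Nat.lt_succ_iff.mp (Finset.mem_range.mp hk)
      calc (C (c j k / (k + 1)) * U ^ j * V ^ (k + 1)).natDegree
          ≤ j * d + (k + 1) * d :=
            natDegree_mul_le_of_le ((natDegree_C_mul_le _ _).trans (natDegree_pow_le_of_le j hU))
              (natDegree_pow_le_of_le (k + 1) hV)
        _ = d * (j + k + 1) := by ring
        _ ≤ d * (p + q + 1) := by gcongr
    have hU' : (derivative U).natDegree ≤ d - 1 :=
      (natDegree_derivative_le U).trans (Nat.sub_le_sub_right hU 1)
    refine (natDegree_mul_le_of_le hA hU').trans ?_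
    have : d * (p + q + 2) = d * (p + q + 1) + d := by ring
    omega
  · simp only [hc, integral_biPoly, Polynomial.deriv, eval_mul, eval_finsetSum, eval_pow, eval_C]

/-- If `g` is a bivariate polynomial of bi-degree at most `(p,q)`,
`A_g(u,v) = ∫₀^v g(u,ξ) dξ`, and `u, v : ℝ → ℝ` are polynomials of degree at most `d`, then
`F(s) = A_g(u s, v s) · u′ s` is a univariate polynomial of degree at most `d(p+q+2) − 1`;
consequently, any quadrature rule with nodes in `[0,1]` that is exact for all polynomials of
degree at most `d(p+q+2) − 1` integrates `F` exactly over `[0,1]`. -/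
theorem pullback_degree_bound_and_quadrature_exactness
    (p q d : ℕ) (g : ℝ → ℝ → ℝ) (hg : IsBiPoly p q g)
    (u v : ℝ → ℝ) (hu : IsPolyDeg d u) (hv : IsPolyDeg d v) :
    IsPolyDeg (d * (p + q + 2) - 1)
        (fun s => (∫ ξ in (0:ℝ)..(v s), g (u s) ξ) * deriv u s) ∧
    ∀ (N : ℕ) (s : Fin N → ℝ) (ω : Fin N → ℝ),
      (∀ μ, s μ ∈ Set.Icc (0:ℝ) 1) →
      (∀ P : ℝ → ℝ, IsPolyDeg (d * (p + q + 2) - 1) P →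
        ∑ μ, ω μ * P (s μ) = ∫ t in (0:ℝ)..1, P t) →
      ∑ μ, ω μ * ((∫ ξ in (0:ℝ)..(v (s μ)), g (u (s μ)) ξ) * deriv u (s μ))
        = ∫ t in (0:ℝ)..1, (∫ ξ in (0:ℝ)..(v t), g (u t) ξ) * deriv u t := by
  have hF := isPolyDeg_pullback p q d g hg u v hu hv
  exact ⟨hF, fun N s ω _ hexact => hexact _ hF⟩
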